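/- Let n > 8. Then for every φ ∈ C_c^∞(B ∖ {0}), ( ∫_B d⁴ φ² λ^n dx ) ( ∫_B λ^{-n} (div(λ^{n-2} ∇φ))² dx ) ≥ (n⁴/16) ( ∫_B φ² λ^n dx )². (In hyperbolic notation: (∫ d⁴ φ² dV)(∫ |Δ_ℍ φ|² dV) ≥ (n⁴/16)(∫ φ² dV)².) -/

import Mathlib

open MeasureTheory

/-- Conformal factor of the Poincaré ball model. -/
noncomputable def lam {n : ℕ} (x : EuclideanSpace ℝ (Fin n)) : ℝ := 2 / (1 - ‖x‖ ^ 2)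

/-- Hyperbolic distance to the origin in the Poincaré ball model. -/
noncomputable def dH {n : ℕ} (x : EuclideanSpace ℝ (Fin n)) : ℝ :=
  Real.log ((1 + ‖x‖) / (1 - ‖x‖))

/-- Euclidean divergence of a vector field on ℝⁿ. -/
noncomputable def dvg {n : ℕ} (V : EuclideanSpace ℝ (Fin n) → EuclideanSpace ℝ (Fin n))
    (x : EuclideanSpace ℝ (Fin n)) : ℝ :=
  ∑ i, fderiv ℝ V x (EuclideanSpace.single i 1) i

local notation "𝔼" n => EuclideanSpace ℝ (Fin n)

section Divergence

variable {n : ℕ}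

theorem dvg_smul {f : (𝔼 n) → ℝ} {V : (𝔼 n) → 𝔼 n} {x : 𝔼 n}
    (hf : DifferentiableAt ℝ f x) (hV : DifferentiableAt ℝ V x) :
    dvg (fun y => f y • V y) x = f x * dvg V x + fderiv ℝ f x (V x) := by
  have hx : V x = ∑ i, V x i • EuclideanSpace.single i (1 : ℝ) := by
    ext j
    simp [Finset.sum_apply, Pi.single_apply]
  unfold dvg
  rw [fderiv_fun_smul hf hV]
  conv_rhs => rw [hx, map_sum]
  simp [Finset.sum_add_distrib, Finset.mul_sum, mul_comm]

theorem dvg_id (x : 𝔼 n) : dvg (fun y => y) x = n := by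
  simp [dvg]

theorem dvg_of_notMem_tsupport {V : (𝔼 n) → 𝔼 n} {x : 𝔼 n} (hx : x ∉ tsupport V) :
    dvg V x = 0 := by
  simp [dvg, fderiv_of_notMem_tsupport ℝ hx]

theorem ContDiffAt.continuousAt_dvg {V : (𝔼 n) → 𝔼 n} {x : 𝔼 n} (hV : ContDiffAt ℝ 1 V x) :
    ContinuousAt (dvg V) x := by
  have h : ContinuousAt (fderiv ℝ V) x := (hV.fderiv_right (m := 0) (by simp)).continuousAt
  unfold dvg
  fun_prop

theorem integral_dvg_eq_zero {V : (𝔼 n) → 𝔼 n} (hV : ContDiff ℝ 1 V)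
    (hc : HasCompactSupport V) : ∫ x, dvg V x = 0 := by
  have key (v : 𝔼 n) : Integrable (fun x => fderiv ℝ V x v) ∧ ∫ x, fderiv ℝ V x v = 0 := by
    have hi : Integrable (fun x => fderiv ℝ V x v) :=
      (by fun_prop : Continuous fun x => fderiv ℝ V x v).integrable_of_hasCompactSupport
        (hc.fderiv_apply ℝ v)
    refine ⟨hi, ?_⟩
    have h := integral_smul_fderiv_eq_neg_fderiv_smul_of_integrable (μ := volume)
      (f := fun _ : 𝔼 n => (1 : ℝ)) (g := V) (v := v) (by simp) (by simpa using hi)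
      (by simpa using hV.continuous.integrable_of_hasCompactSupport hc)
      (fun x _ => differentiableAt_const _) (fun x _ => hV.differentiable (by simp) x)
    simpa using h
  have coord (i : Fin n) : Integrable (fun x => fderiv ℝ V x (EuclideanSpace.single i 1) i) ∧
      ∫ x, fderiv ℝ V x (EuclideanSpace.single i 1) i = 0 := by
    obtain ⟨h1, h2⟩ := key (EuclideanSpace.single i 1)
    refine ⟨(EuclideanSpace.proj (𝕜 := ℝ) i).integrable_comp h1, ?_⟩
    have h := (EuclideanSpace.proj (𝕜 := ℝ) i : (𝔼 n) →L[ℝ] ℝ).integral_comp_comm h1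
    rw [h2] at h
    simpa using h
  unfold dvg
  rw [integral_finsetSum _ fun i _ => (coord i).1]
  exact Finset.sum_eq_zero fun i _ => (coord i).2

/-- Green's formula for a compactly supported `f`. -/
theorem setIntegral_tsupport_mul_dvg_add {f : (𝔼 n) → ℝ} {V : (𝔼 n) → 𝔼 n} (hf : ContDiff ℝ 1 f)
    (hc : HasCompactSupport f) (hV : ∀ x ∈ tsupport f, ContDiffAt ℝ 1 V x) :
    ∫ x in tsupport f, (f x * dvg V x + fderiv ℝ f x (V x)) = 0 := by
  have hsub : (tsupport fun x => f x • V x) ⊆ tsupport f := tsupport_smul_subset_left f V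
  have hfV : ContDiff ℝ 1 fun x => f x • V x :=
    contDiff_iff_contDiffAt.2 fun x => by
      by_cases hx : x ∈ tsupport f
      · exact hf.contDiffAt.smul (hV x hx)
      · exact contDiffAt_const.congr_of_eventuallyEq
          (notMem_tsupport_iff_eventuallyEq.1 fun h => hx (hsub h))
  rw [← integral_dvg_eq_zero hfV (hc.smul_right),
    ← setIntegral_eq_integral_of_forall_compl_eq_zero (s := tsupport f)
      fun x hx => dvg_of_notMem_tsupport fun h => hx (hsub h)]
  refine setIntegral_congr_fun (isClosed_tsupport f).measurableSet fun x hx => ?_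
  exact (dvg_smul (hf.differentiable (by simp) x) ((hV x hx).differentiableAt (by simp))).symm

end Divergence

/-- Weighted Cauchy–Schwarz inequality for continuous functions on a compact set. -/
theorem sq_setIntegral_mul_le {X : Type*} [TopologicalSpace X] [T2Space X] [MeasurableSpace X]
    [OpensMeasurableSpace X] {μ : Measure X} [IsFiniteMeasureOnCompacts μ]
    {K : Set X} (hK : IsCompact K) {f g w : X → ℝ} (hf : ContinuousOn f K) (hg : ContinuousOn g K)
    (hw : ContinuousOn w K) (hw0 : ∀ x ∈ K, 0 ≤ w x) :
    (∫ x in K, f x * g x * w x ∂μ) ^ 2 ≤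
      (∫ x in K, f x ^ 2 * w x ∂μ) * ∫ x in K, g x ^ 2 * w x ∂μ := by
  have hff : IntegrableOn (fun x => f x ^ 2 * w x) K μ :=
    ((hf.pow 2).mul hw).integrableOn_compact hK
  have hgg : IntegrableOn (fun x => g x ^ 2 * w x) K μ :=
    ((hg.pow 2).mul hw).integrableOn_compact hK
  have hfg : IntegrableOn (fun x => f x * g x * w x) K μ :=
    ((hf.mul hg).mul hw).integrableOn_compact hK
  have h := discrim_le_zero (a := ∫ x in K, f x ^ 2 * w x ∂μ)
    (b := 2 * ∫ x in K, f x * g x * w x ∂μ) (c := ∫ x in K, g x ^ 2 * w x ∂μ) fun t => by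
      have h0 : 0 ≤ ∫ x in K, (t * f x + g x) ^ 2 * w x ∂μ :=
        setIntegral_nonneg hK.measurableSet fun x hx => mul_nonneg (sq_nonneg _) (hw0 x hx)
      have he : ∀ x, (t * f x + g x) ^ 2 * w x =
          t * t * (f x ^ 2 * w x) + 2 * t * (f x * g x * w x) + g x ^ 2 * w x := fun x => by ring
      simp only [he] at h0
      have hsum : IntegrableOn
          (fun x => t * t * (f x ^ 2 * w x) + 2 * t * (f x * g x * w x)) K μ :=
        (hff.const_mul _).add (hfg.const_mul _)
      rw [integral_add hsum hgg, integral_add (hff.const_mul _) (hfg.const_mul _),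
        integral_const_mul, integral_const_mul] at h0
      linarith
  rw [discrim] at h
  linarith

section Radial

theorem two_mul_le_log_one_add_div_one_sub {r : ℝ} (h0 : 0 ≤ r) (h1 : r < 1) :
    2 * r ≤ Real.log ((1 + r) / (1 - r)) := by
  have h := Real.hasSum_log_sub_log_of_abs_lt_one (abs_lt.2 ⟨by linarith, h1⟩)
  rw [Real.log_div (by linarith) (by linarith)]
  have := le_hasSum h 0 fun k _ => by positivity
  simpa using this

variable {n : ℕ}

theorem lam_pos {x : 𝔼 n} (hx : ‖x‖ < 1) : 0 < lam x := by
  have := norm_nonneg x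
  exact div_pos two_pos (by nlinarith)

theorem dH_nonneg {x : 𝔼 n} (hx : ‖x‖ < 1) : 0 ≤ dH x :=
  (by positivity : 0 ≤ 2 * ‖x‖).trans (two_mul_le_log_one_add_div_one_sub (norm_nonneg x) hx)

theorem contDiffAt_lam {x : 𝔼 n} (hx : ‖x‖ < 1) : ContDiffAt ℝ 1 lam x := by
  have := norm_nonneg x
  have h : 1 - ‖x‖ ^ 2 ≠ 0 := by nlinarith
  unfold lam
  exact contDiffAt_const.div (contDiffAt_const.sub (contDiff_norm_sq ℝ).contDiffAt) h

theorem contDiffAt_dH {x : 𝔼 n} (hx : ‖x‖ < 1) (hx0 : x ≠ 0) : ContDiffAt ℝ 1 dH x := by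
  have := norm_nonneg x
  have h1 : 1 - ‖x‖ ≠ 0 := by linarith
  have h : (1 + ‖x‖) / (1 - ‖x‖) ≠ 0 := div_ne_zero (by linarith) h1
  have hn : ContDiffAt ℝ 1 (fun y : 𝔼 n => ‖y‖) x := contDiffAt_norm ℝ hx0
  unfold dH
  exact ((contDiffAt_const.add hn).div (contDiffAt_const.sub hn) h1).log h

/-- The coefficient `λ ^ m d / |x|` of a radial field; for `m = n - 1`, the field
`radialCoeff m x • x` is the Euclidean representative of the hyperbolic gradient of `d ^ 2 / 2`,
multiplied by the volume density `λ ^ n`. -/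
noncomputable def radialCoeff (m : ℕ) {n : ℕ} (x : 𝔼 n) : ℝ := lam x ^ m * dH x / ‖x‖

theorem contDiffAt_radialCoeff (m : ℕ) {x : 𝔼 n} (hx : ‖x‖ < 1) (hx0 : x ≠ 0) :
    ContDiffAt ℝ 1 (radialCoeff m : (𝔼 n) → ℝ) x :=
  (((contDiffAt_lam hx).pow m).mul (contDiffAt_dH hx hx0)).div (contDiffAt_norm ℝ hx0)
    (norm_ne_zero_iff.2 hx0)

theorem fderiv_radialCoeff_self (m : ℕ) {x : 𝔼 n} (hx : ‖x‖ < 1) (hx0 : x ≠ 0) :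
    fderiv ℝ (radialCoeff (m + 1) : (𝔼 n) → ℝ) x x =
      (m + 1) * lam x ^ (m + 2) * ‖x‖ * dH x + lam x ^ (m + 2)
        - lam x ^ (m + 1) * dH x / ‖x‖ := by
  have hr : 0 < ‖x‖ := norm_pos_iff.2 hx0
  have h1 : 1 - ‖x‖ ≠ 0 := by linarith
  have h1' : 1 + ‖x‖ ≠ 0 := by linarith
  have h2 : 1 - ‖x‖ ^ 2 ≠ 0 := by nlinarith
  have hl : HasDerivAt (fun t : ℝ => 2 / (1 - t ^ 2)) (‖x‖ * lam x ^ 2) ‖x‖ := by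
    have := (((hasDerivAt_id ‖x‖).fun_pow 2).const_sub 1).fun_inv h2 |>.const_mul 2
    refine this.congr_deriv ?_
    simp only [lam, id]
    field_simp
    norm_num
  have hd : HasDerivAt (fun t : ℝ => Real.log ((1 + t) / (1 - t))) (lam x) ‖x‖ := by
    have := (((hasDerivAt_id ‖x‖).const_add 1).fun_div ((hasDerivAt_id ‖x‖).const_sub 1) h1).log
      (div_ne_zero h1' h1)
    refine this.congr_deriv ?_
    have h3 : (1 - ‖x‖ ^ 2) = (1 - ‖x‖) * (1 + ‖x‖) := by ring
    simp only [lam, id, h3]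
    field_simp
    ring
  have hg := ((hl.fun_pow (m + 1)).fun_mul hd).fun_div (hasDerivAt_id ‖x‖) hr.ne'
  have hd' : DifferentiableAt ℝ (fun y : 𝔼 n => ‖y‖) x :=
    (contDiffAt_norm ℝ hx0 (n := 1)).differentiableAt (by simp)
  have hcomp := (hg.comp_hasFDerivAt x hd'.hasFDerivAt).fderiv
  have he : (radialCoeff (m + 1) : (𝔼 n) → ℝ) = (fun t : ℝ => (2 / (1 - t ^ 2)) ^ (m + 1) *
      Real.log ((1 + t) / (1 - t)) / id t) ∘ fun y : 𝔼 n => ‖y‖ := rfl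
  have hl' : 2 / (1 - ‖x‖ ^ 2) = lam x := rfl
  have hd'' : Real.log ((1 + ‖x‖) / (1 - ‖x‖)) = dH x := rfl
  rw [he, hcomp, smul_apply, hd'.fderiv_norm_self, hl', hd'']
  simp only [id, smul_eq_mul, Nat.add_sub_cancel]
  push_cast
  field_simp
  ring

theorem le_dvg_radialCoeff_smul (m : ℕ) {x : 𝔼 (m + 2)} (hx : ‖x‖ < 1) (hx0 : x ≠ 0) :
    ((m + 2 : ℕ) : ℝ) * lam x ^ (m + 2) ≤
      dvg (fun y : 𝔼 (m + 2) => radialCoeff (m + 1) y • y) x := by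
  have hr : 0 < ‖x‖ := norm_pos_iff.2 hx0
  rw [dvg_smul ((contDiffAt_radialCoeff _ hx hx0).differentiableAt (by simp))
    differentiableAt_fun_id, dvg_id, fderiv_radialCoeff_self m hx hx0, radialCoeff]
  have hlam := lam_pos hx
  have hd : 2 * ‖x‖ ≤ dH x := two_mul_le_log_one_add_div_one_sub hr.le hx
  have h2 : 0 < 1 - ‖x‖ ^ 2 := by nlinarith
  have hl : lam x * (1 - ‖x‖ ^ 2) = 2 := div_mul_cancel₀ _ h2.ne'
  have key : lam x ≤ dH x / ‖x‖ * (1 + lam x * ‖x‖ ^ 2) := by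
    have h3 : 2 ≤ dH x / ‖x‖ := (le_div_iff₀ hr).2 hd
    have h4 : 1 + lam x * ‖x‖ ^ 2 = lam x / 2 * (1 + ‖x‖ ^ 2) := by linarith
    rw [h4]
    have h5 : 0 ≤ lam x / 2 * (1 + ‖x‖ ^ 2) := by positivity
    have h6 : 0 ≤ lam x * ‖x‖ ^ 2 := by positivity
    nlinarith [mul_le_mul_of_nonneg_right h3 h5]
  have h7 := mul_le_mul_of_nonneg_left key
    (by positivity : 0 ≤ ((m : ℝ) + 1) * lam x ^ (m + 1))
  have h8 : dH x / ‖x‖ * ‖x‖ = dH x := div_mul_cancel₀ _ hr.ne'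
  push_cast
  rw [mul_div_assoc]
  calc ((m : ℝ) + 2) * lam x ^ (m + 2)
      = (m + 1) * lam x ^ (m + 1) * lam x + lam x ^ (m + 2) := by ring
    _ ≤ _ := by grw [h7]
    _ = _ := by
      linear_combination ((m : ℝ) + 1) * lam x ^ (m + 2) * ‖x‖ * h8

end Radial

section Inequalities

variable {m : ℕ} {φ : (𝔼 (m + 2)) → ℝ}

theorem first_order_uncertainty (hφ : ContDiff ℝ (⊤ : ℕ∞) φ) (hc : HasCompactSupport φ)
    (hs : tsupport φ ⊆ Metric.ball (0 : 𝔼 (m + 2)) 1 \ {0}) :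
    (((m + 2 : ℕ) : ℝ) * ∫ x in tsupport φ, φ x ^ 2 * lam x ^ (m + 2)) ^ 2 ≤
      4 * ((∫ x in tsupport φ, (dH x * φ x) ^ 2 * lam x ^ (m + 2)) *
        ∫ x in tsupport φ, (‖fderiv ℝ φ x‖ / lam x) ^ 2 * lam x ^ (m + 2)) := by
  have hB {x} (hx : x ∈ tsupport φ) : ‖x‖ < 1 := by simpa using (hs hx).1
  have h0 {x} (hx : x ∈ tsupport φ) : x ≠ 0 := (hs hx).2
  have hφ1 : ContDiff ℝ 1 φ := hφ.of_le (by exact_mod_cast le_top)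
  have hK : IsCompact (tsupport φ) := hc
  have hlam : ContinuousOn (lam : (𝔼 (m + 2)) → ℝ) (tsupport φ) := fun x hx =>
    (contDiffAt_lam (hB hx)).continuousAt.continuousWithinAt
  have hlam0 : ∀ x ∈ tsupport φ, lam x ≠ 0 := fun x hx => (lam_pos (hB hx)).ne'
  have hdH : ContinuousOn (dH : (𝔼 (m + 2)) → ℝ) (tsupport φ) := fun x hx =>
    (contDiffAt_dH (hB hx) (h0 hx)).continuousAt.continuousWithinAt
  have hφc : ContinuousOn φ (tsupport φ) := hφ1.continuous.continuousOn
  have hDφ : Continuous (fderiv ℝ φ) := hφ1.continuous_fderiv (by simp)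
  set V : (𝔼 (m + 2)) → 𝔼 (m + 2) := fun y => radialCoeff (m + 1) y • y with hVdef
  have hV : ∀ x ∈ tsupport φ, ContDiffAt ℝ 1 V x := fun x hx =>
    (contDiffAt_radialCoeff _ (hB hx) (h0 hx)).smul contDiffAt_id
  have hVn : ∀ x ∈ tsupport φ, ‖V x‖ = lam x ^ (m + 1) * dH x := fun x hx => by
    have := lam_pos (hB hx)
    have := dH_nonneg (hB hx)
    have := norm_pos_iff.2 (h0 hx)
    rw [hVdef, norm_smul, radialCoeff, Real.norm_of_nonneg (by positivity),
      div_mul_cancel₀ _ (by positivity)]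
  have hgreen := setIntegral_tsupport_mul_dvg_add hφ1 hc
    (V := fun y => φ y • V y) fun x hx => hφ1.contDiffAt.smul (hV x hx)
  have hle : 0 ≤ ∫ x in tsupport φ, (2 * (dH x * |φ x| * (‖fderiv ℝ φ x‖ / lam x) * lam x ^ (m + 2))
      - ((m + 2 : ℕ) : ℝ) * (φ x ^ 2 * lam x ^ (m + 2))) := by
    rw [← neg_zero, ← hgreen, ← integral_neg]
    refine setIntegral_mono_on ?_ ?_ hK.measurableSet fun x hx => ?_
    · refine ContinuousOn.integrableOn_compact hK (.neg (.add (.mul hφc fun x hx => ?_)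
        fun x hx => ?_))
      · exact (hφ1.contDiffAt.smul (hV x hx)).continuousAt_dvg.continuousWithinAt
      · exact (hDφ.continuousAt.clm_apply
          (hφ1.continuous.continuousAt.smul (hV x hx).continuousAt)).continuousWithinAt
    · exact ContinuousOn.integrableOn_compact hK (by fun_prop (disch := assumption))
    · have hd := mul_le_mul_of_nonneg_left (le_dvg_radialCoeff_smul m (hB hx) (h0 hx))
        (sq_nonneg (φ x))
      have hl := lam_pos (hB hx)
      rw [dvg_smul (hφ1.differentiable (by simp) x) ((hV x hx).differentiableAt (by simp)),
        map_smul (fderiv ℝ φ x) (φ x) (V x), smul_eq_mul]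
      have h1 : -(φ x * fderiv ℝ φ x (V x)) ≤
          dH x * |φ x| * (‖fderiv ℝ φ x‖ / lam x) * lam x ^ (m + 2) := by
        calc -(φ x * fderiv ℝ φ x (V x)) ≤ |φ x| * ‖fderiv ℝ φ x (V x)‖ := by
              rw [Real.norm_eq_abs, ← abs_mul]
              exact neg_le_abs _
          _ ≤ |φ x| * (‖fderiv ℝ φ x‖ * (lam x ^ (m + 1) * dH x)) := by
              rw [← hVn x hx]
              gcongr
              exact ContinuousLinearMap.le_opNorm _ _
          _ = _ := by
              field_simp
              ring
      linarith
  rw [integral_sub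
    (ContinuousOn.integrableOn_compact hK (by fun_prop (disch := assumption)))
    (ContinuousOn.integrableOn_compact hK (by fun_prop (disch := assumption))),
    integral_const_mul, integral_const_mul] at hle
  have hcs := sq_setIntegral_mul_le (μ := volume) hK (f := fun x => dH x * |φ x|)
    (g := fun x => ‖fderiv ℝ φ x‖ / lam x) (w := fun x => lam x ^ (m + 2))
    (by fun_prop) (by fun_prop (disch := assumption)) (by fun_prop)
    fun x hx => pow_nonneg (lam_pos (hB hx)).le _
  simp only [mul_pow, sq_abs] at hcs ⊢
  have hA : 0 ≤ ((m + 2 : ℕ) : ℝ) * ∫ x in tsupport φ, φ x ^ 2 * lam x ^ (m + 2) :=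
    mul_nonneg (Nat.cast_nonneg _) <| setIntegral_nonneg hK.measurableSet fun x hx =>
      mul_nonneg (sq_nonneg _) (pow_nonneg (lam_pos (hB hx)).le _)
  rw [← mul_pow]
  refine (pow_le_pow_left₀ hA (sub_nonneg.1 hle) 2).trans ?_
  rw [mul_pow]
  linarith

theorem sq_integral_gradient_le (hφ : ContDiff ℝ (⊤ : ℕ∞) φ) (hc : HasCompactSupport φ)
    (hs : tsupport φ ⊆ Metric.ball (0 : 𝔼 (m + 2)) 1 \ {0}) :
    (∫ x in tsupport φ, (‖fderiv ℝ φ x‖ / lam x) ^ 2 * lam x ^ (m + 2)) ^ 2 ≤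
      (∫ x in tsupport φ, φ x ^ 2 * lam x ^ (m + 2)) *
        ∫ x in tsupport φ, (lam x ^ (m + 2))⁻¹ *
          dvg (fun y => lam y ^ m • gradient φ y) x ^ 2 := by
  have hB {x} (hx : x ∈ tsupport φ) : ‖x‖ < 1 := by simpa using (hs hx).1
  have hφ1 : ContDiff ℝ 1 φ := hφ.of_le (by exact_mod_cast le_top)
  have hφ2 : ContDiff ℝ 2 φ := hφ.of_le (WithTop.coe_le_coe.2 le_top)
  have hK : IsCompact (tsupport φ) := hc
  have hlam : ContinuousOn (lam : (𝔼 (m + 2)) → ℝ) (tsupport φ) := fun x hx =>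
    (contDiffAt_lam (hB hx)).continuousAt.continuousWithinAt
  have hlam0 : ∀ x ∈ tsupport φ, lam x ^ (m + 2) ≠ 0 := fun x hx =>
    (pow_pos (lam_pos (hB hx)) _).ne'
  have hφc : ContinuousOn φ (tsupport φ) := hφ1.continuous.continuousOn
  have hgrad : ContDiff ℝ 1 (gradient φ) :=
    (InnerProductSpace.toDual ℝ (𝔼 (m + 2))).symm.contDiff.comp (hφ2.fderiv_right (by norm_num))
  set V : (𝔼 (m + 2)) → 𝔼 (m + 2) := fun y => lam y ^ m • gradient φ y with hVdef
  have hV : ∀ x ∈ tsupport φ, ContDiffAt ℝ 1 V x := fun x hx =>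
    ((contDiffAt_lam (hB hx)).pow m).smul hgrad.contDiffAt
  have hdvg : ContinuousOn (dvg V) (tsupport φ) := fun x hx =>
    (hV x hx).continuousAt_dvg.continuousWithinAt
  have hDφ : Continuous (fderiv ℝ φ) := hφ1.continuous_fderiv (by simp)
  have hgreen := setIntegral_tsupport_mul_dvg_add hφ1 hc hV
  have hfd : ∀ x, fderiv ℝ φ x (V x) = lam x ^ m * ‖fderiv ℝ φ x‖ ^ 2 := fun x => by
    rw [hVdef, map_smul, ← inner_gradient_left, real_inner_self_eq_norm_sq, smul_eq_mul, gradient,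
      LinearIsometryEquiv.norm_map]
  simp only [hfd] at hgreen
  rw [integral_add (ContinuousOn.integrableOn_compact hK (by fun_prop))
    (ContinuousOn.integrableOn_compact hK (by fun_prop))] at hgreen
  have hcs := sq_setIntegral_mul_le (μ := volume) hK (f := φ)
    (g := fun x => (lam x ^ (m + 2))⁻¹ * dvg V x) (w := fun x => lam x ^ (m + 2))
    hφc (by fun_prop (disch := assumption)) (by fun_prop)
    fun x hx => pow_nonneg (lam_pos (hB hx)).le _
  have e1 : ∫ x in tsupport φ, φ x * ((lam x ^ (m + 2))⁻¹ * dvg V x) * lam x ^ (m + 2) =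
      ∫ x in tsupport φ, φ x * dvg V x :=
    setIntegral_congr_fun hK.measurableSet fun x hx => by
      have := lam_pos (hB hx)
      field_simp
  have e2 : ∫ x in tsupport φ, ((lam x ^ (m + 2))⁻¹ * dvg V x) ^ 2 * lam x ^ (m + 2) =
      ∫ x in tsupport φ, (lam x ^ (m + 2))⁻¹ * dvg V x ^ 2 :=
    setIntegral_congr_fun hK.measurableSet fun x hx => by
      have := lam_pos (hB hx)
      field_simp
  have e3 : ∫ x in tsupport φ, (‖fderiv ℝ φ x‖ / lam x) ^ 2 * lam x ^ (m + 2) =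
      ∫ x in tsupport φ, lam x ^ m * ‖fderiv ℝ φ x‖ ^ 2 :=
    setIntegral_congr_fun hK.measurableSet fun x hx => by
      have := lam_pos (hB hx)
      field_simp
      ring
  rw [e1, e2, eq_neg_of_add_eq_zero_left hgreen, neg_sq] at hcs
  rwa [e3]

theorem sq_integral_dH_le (hφ : Continuous φ) (hc : HasCompactSupport φ)
    (hs : tsupport φ ⊆ Metric.ball (0 : 𝔼 (m + 2)) 1 \ {0}) :
    (∫ x in tsupport φ, (dH x * φ x) ^ 2 * lam x ^ (m + 2)) ^ 2 ≤
      (∫ x in tsupport φ, dH x ^ 4 * φ x ^ 2 * lam x ^ (m + 2)) *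
        ∫ x in tsupport φ, φ x ^ 2 * lam x ^ (m + 2) := by
  have hB {x} (hx : x ∈ tsupport φ) : ‖x‖ < 1 := by simpa using (hs hx).1
  have hlam : ContinuousOn (lam : (𝔼 (m + 2)) → ℝ) (tsupport φ) := fun x hx =>
    (contDiffAt_lam (hB hx)).continuousAt.continuousWithinAt
  have hdH : ContinuousOn (dH : (𝔼 (m + 2)) → ℝ) (tsupport φ) := fun x hx =>
    (contDiffAt_dH (hB hx) (hs hx).2).continuousAt.continuousWithinAt
  have hcs := sq_setIntegral_mul_le (μ := volume) hc.isCompact (f := fun x => dH x ^ 2 * φ x)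
    (g := φ) (w := fun x => lam x ^ (m + 2)) (by fun_prop) (by fun_prop) (by fun_prop)
    fun x hx => pow_nonneg (lam_pos (hB hx)).le _
  convert hcs using 5 <;> ring

end Inequalities

/-- Second order Heisenberg–Pauli–Weyl uncertainty principle inequality on
hyperbolic space (Corollary 4.1). -/
theorem second_order_uncertainty_principle_hyperbolic {n : ℕ} (hn : 8 < n)
    (φ : EuclideanSpace ℝ (Fin n) → ℝ)
    (hφ_smooth : ContDiff ℝ (⊤ : ℕ∞) φ) (hφ_cpt : HasCompactSupport φ)
    (hφ_supp : tsupport φ ⊆ Metric.ball (0 : EuclideanSpace ℝ (Fin n)) 1 \ {0}) :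
    (n : ℝ) ^ 4 / 16 *
        (∫ x in Metric.ball (0 : EuclideanSpace ℝ (Fin n)) 1,
          φ x ^ 2 * lam x ^ (n : ℝ)) ^ 2 ≤
      (∫ x in Metric.ball (0 : EuclideanSpace ℝ (Fin n)) 1,
          dH x ^ 4 * φ x ^ 2 * lam x ^ (n : ℝ)) *
        ∫ x in Metric.ball (0 : EuclideanSpace ℝ (Fin n)) 1,
          lam x ^ (-(n : ℝ)) *
            (dvg (fun y => lam y ^ ((n : ℝ) - 2) • gradient φ y) x) ^ 2 := by
  obtain ⟨m, rfl⟩ : ∃ m, n = m + 2 := ⟨n - 2, by omega⟩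
  have hexp : ((m + 2 : ℕ) : ℝ) - 2 = (m : ℕ) := by push_cast; ring
  have hB {x} (hx : x ∈ tsupport φ) : ‖x‖ < 1 := by simpa using (hφ_supp hx).1
  have hK : MeasurableSet (tsupport φ) := (isClosed_tsupport φ).measurableSet
  have hrestrict {f : EuclideanSpace ℝ (Fin (m + 2)) → ℝ} (hf : ∀ x, x ∉ tsupport φ → f x = 0) :
      ∫ x in Metric.ball (0 : EuclideanSpace ℝ (Fin (m + 2))) 1, f x = ∫ x in tsupport φ, f x :=
    setIntegral_eq_of_subset_of_forall_sdiff_eq_zero measurableSet_ball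
      (fun x hx => (hφ_supp hx).1) fun x hx => hf x hx.2
  have hgrad : tsupport (gradient φ) ⊆ tsupport φ :=
    (tsupport_comp_subset (map_zero _) _).trans (tsupport_fderiv_subset ℝ)
  simp only [hexp, Real.rpow_natCast]
  rw [hrestrict fun x hx => by simp [image_eq_zero_of_notMem_tsupport hx],
    hrestrict fun x hx => by simp [image_eq_zero_of_notMem_tsupport hx],
    hrestrict fun x hx => by
      rw [dvg_of_notMem_tsupport fun h => hx (hgrad (tsupport_smul_subset_right _ _ h))]
      simp]
  have hinv : ∫ x in tsupport φ, lam x ^ (-((m + 2 : ℕ) : ℝ)) *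
      dvg (fun y => lam y ^ m • gradient φ y) x ^ 2 = ∫ x in tsupport φ, (lam x ^ (m + 2))⁻¹ *
      dvg (fun y => lam y ^ m • gradient φ y) x ^ 2 :=
    setIntegral_congr_fun hK fun x hx => by
      simp only [Real.rpow_neg (lam_pos (hB hx)).le, Real.rpow_natCast]
  rw [hinv]
  have h1 := first_order_uncertainty hφ_smooth hφ_cpt hφ_supp
  have h2 := sq_integral_gradient_le hφ_smooth hφ_cpt hφ_supp
  have h3 := sq_integral_dH_le hφ_smooth.continuous hφ_cpt hφ_supp
  have hA : 0 ≤ ∫ x in tsupport φ, φ x ^ 2 * lam x ^ (m + 2) :=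
    setIntegral_nonneg hK fun x hx =>
      mul_nonneg (sq_nonneg _) (pow_nonneg (lam_pos (hB hx)).le _)
  have hD : 0 ≤ ∫ x in tsupport φ, dH x ^ 4 * φ x ^ 2 * lam x ^ (m + 2) :=
    setIntegral_nonneg hK fun x hx => by
      have := lam_pos (hB hx)
      positivity
  have hL : 0 ≤ ∫ x in tsupport φ, (lam x ^ (m + 2))⁻¹ *
      dvg (fun y => lam y ^ m • gradient φ y) x ^ 2 :=
    setIntegral_nonneg hK fun x hx => by
      have := lam_pos (hB hx)
      positivity
  generalize (∫ x in tsupport φ, φ x ^ 2 * lam x ^ (m + 2)) = A at *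
  generalize (∫ x in tsupport φ, dH x ^ 4 * φ x ^ 2 * lam x ^ (m + 2)) = D at *
  generalize (∫ x in tsupport φ, (lam x ^ (m + 2))⁻¹ *
      dvg (fun y => lam y ^ m • gradient φ y) x ^ 2) = L at *
  generalize (∫ x in tsupport φ, (dH x * φ x) ^ 2 * lam x ^ (m + 2)) = P at *
  generalize (∫ x in tsupport φ, (‖fderiv ℝ φ x‖ / lam x) ^ 2 * lam x ^ (m + 2)) = G at *
  generalize ((m + 2 : ℕ) : ℝ) = N at *
  rcases hA.eq_or_lt with rfl | hA
  · simpa using mul_nonneg hD hL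
  have h4 : ((N * A) ^ 2) ^ 2 ≤ (4 * (P * G)) ^ 2 := pow_le_pow_left₀ (sq_nonneg _) h1 2
  have h5 : P ^ 2 * G ^ 2 ≤ D * A * (A * L) :=
    mul_le_mul h3 h2 (sq_nonneg _) (mul_nonneg hD hA.le)
  have h6 : N ^ 4 / 16 * A ^ 2 * A ^ 2 ≤ D * L * A ^ 2 := by linarith
  exact le_of_mul_le_mul_right h6 (by positivity)
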